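/- arXiv:math/0502215 — 4 statements merged into one kernel-verified Lean document; each statement's English description precedes it below -/
import Mathlib

section
/- Let v be a smooth vector field in the plane with flow X_t, and let μ₀ = γ₀ δ_{C₀} be a Radon measure supported on a smooth curve C₀ with smooth density γ₀. Let μ(·,t) be the transport of μ₀ by v, i.e. μ(E,t) = μ₀(X_{−t}(E)) for all Borel sets E, so that μ(·,t) = γ δ_{C_t} with C_t = X_t(C₀). Let y = y(η,t) be any (smooth) parametrization of C_t and set σ(η,t) := γ(s(η,t),t) ∂s/∂η, where s = s(η,t) is arclength along C_t from a reference point. Then there exists a function a = a(η,t) such that y_t + a y_η = v(y,t) and σ_t + (a σ)_η = 0. -/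
/-!
STATEMENT 3 (Lemma `lemmachtung`): transport of a measure γ₀ δ_{C₀} by a smooth
vector field v, expressed in an arbitrary parametrization y(η,t) of C_t = X_t(C₀),
satisfies y_t + a y_η = v and σ_t + (aσ)_η = 0 for some function a. -/

open MeasureTheory Real Filter Set Function
open scoped Topology

noncomputable section

abbrev R2 : Type := EuclideanSpace ℝ (Fin 2)

section ODE

variable {G E : Type*} [NormedAddCommGroup G] [NormedSpace ℝ G]
  [NormedAddCommGroup E] [NormedSpace ℝ E]

/-- A `C¹` map is uniformly differentiable along a compact set. -/
theorem IsCompact.exists_norm_sub_sub_fderiv_le {K : Set G} (hK : IsCompact K) {V : G → E}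
    (hV : ContDiff ℝ 1 V) {ε : ℝ} (hε : 0 < ε) :
    ∃ δ > 0, ∀ p ∈ K, ∀ q, ‖q - p‖ < δ → ‖V q - V p - fderiv ℝ V p (q - p)‖ ≤ ε * ‖q - p‖ := by
  have hc : Continuous (fderiv ℝ V) := hV.continuous_fderiv one_ne_zero
  have hu := hK.uniformContinuousAt_of_continuousAt (fderiv ℝ V) (fun x _ => hc.continuousAt)
    (Metric.dist_mem_uniformity hε)
  obtain ⟨δ, hδ, h⟩ := Metric.mem_uniformity_dist.1 hu
  refine ⟨δ, hδ, fun p hp q hq => ?_⟩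
  refine (convex_ball p δ).norm_image_sub_le_of_norm_fderiv_le' (𝕜 := ℝ)
    (fun x _ => (hV.differentiable one_ne_zero) x) (fun x hx => ?_)
    (Metric.mem_ball_self hδ) (by simpa [dist_eq_norm] using hq)
  have := h (a := p) (b := x) (by rw [dist_comm]; exact hx) hp
  rw [← dist_eq_norm, dist_comm]
  exact le_of_lt this

/-- An integral curve close to `u` at time `0` stays close to it: if the field
is Lipschitz with constant `L` on pairs `(x, u t)` at distance less than `δ`, Grönwall's bound
holds for every solution starting close enough to `u`. -/
theorem norm_sub_le_of_lipschitz_near {v : E → ℝ → E} {u w : ℝ → E} {L δ T : ℝ} (hL : 0 ≤ L)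
    (hlip : ∀ t ∈ Icc 0 T, ∀ x, ‖x - u t‖ < δ → ‖v x t - v (u t) t‖ ≤ L * ‖x - u t‖)
    (hu : ∀ t, HasDerivAt u (v (u t) t) t) (hw : ∀ t, HasDerivAt w (v (w t) t) t)
    (hδ : ‖w 0 - u 0‖ * exp (L * T) < δ) :
    ∀ t ∈ Icc 0 T, ‖w t - u t‖ ≤ ‖w 0 - u 0‖ * exp (L * T) := by
  have hcont : Continuous fun t => w t - u t :=
    continuous_iff_continuousAt.2 fun t => ((hw t).sub (hu t)).continuousAt
  have key : ∀ t ∈ Icc 0 T, (∀ τ ∈ Ico 0 t, ‖w τ - u τ‖ < δ) →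
      ‖w t - u t‖ ≤ ‖w 0 - u 0‖ * exp (L * T) := by
    intro t ht hτ
    have := norm_le_gronwallBound_of_norm_deriv_right_le (f := fun t => w t - u t)
      (f' := fun t => v (w t) t - v (u t) t) (K := L) (ε := 0) (δ := ‖w 0 - u 0‖) (a := 0) (b := t)
      hcont.continuousOn (fun x _ => ((hw x).sub (hu x)).hasDerivWithinAt) le_rfl
      (fun x hx => by
        rw [add_zero]; exact hlip x ⟨hx.1, hx.2.le.trans ht.2⟩ _ (hτ x hx)) t
      (right_mem_Icc.2 ht.1)
    rw [gronwallBound_ε0, sub_zero] at this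
    refine this.trans ?_
    gcongr
    exact ht.2
  intro t ht
  refine key t ht ?_
  by_contra! hne
  obtain ⟨τ₀, hτ₀, hτ₀'⟩ := hne
  have hS : IsCompact (Icc 0 T ∩ {τ | δ ≤ ‖w τ - u τ‖}) :=
    isCompact_Icc.inter_right (isClosed_le continuous_const hcont.norm)
  obtain ⟨m, ⟨hmI, hm⟩, hmin⟩ := hS.exists_isLeast ⟨τ₀, ⟨hτ₀.1, hτ₀.2.le.trans ht.2⟩, hτ₀'⟩
  have hm' : δ ≤ ‖w m - u m‖ := hm
  have := key m hmI fun τ hτ => by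
    by_contra! h
    exact absurd (hmin ⟨⟨hτ.1, hτ.2.le.trans hmI.2⟩, h⟩) (not_le.2 hτ.2)
  linarith

variable {v : E → ℝ → E}

theorem exists_lipschitz_near (hv : ContDiff ℝ 1 ↿v) {u : ℝ → E} (hu : Continuous u) (T : ℝ) :
    ∃ L ≥ 0, ∃ δ > 0, (∀ t ∈ Icc 0 T, ‖(fderiv ℝ ↿v (u t, t)).comp (.inl ℝ E ℝ)‖ ≤ L) ∧
      ∀ t ∈ Icc 0 T, ∀ x, ‖x - u t‖ < δ → ‖v x t - v (u t) t‖ ≤ L * ‖x - u t‖ := by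
  have hK : IsCompact ((fun t => (u t, t)) '' Icc 0 T) := isCompact_Icc.image (by fun_prop)
  obtain ⟨δ, hδ, hdiff⟩ := hK.exists_norm_sub_sub_fderiv_le hv one_pos
  have hA : Continuous fun t => (fderiv ℝ ↿v (u t, t)).comp (.inl ℝ E ℝ) :=
    ((hv.continuous_fderiv one_ne_zero).comp (by fun_prop : Continuous fun t => (u t, t))).clm_comp
      continuous_const
  obtain ⟨M, hM⟩ := isCompact_Icc.exists_bound_of_continuousOn (s := Icc 0 T) hA.continuousOn
  refine ⟨|M| + 1, by positivity, δ, hδ, fun t ht => (hM t ht).trans ?_, fun t ht x hx => ?_⟩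
  · linarith [le_abs_self M]
  have hn : ‖((x, t) : E × ℝ) - (u t, t)‖ = ‖x - u t‖ := by simp [Prod.norm_def]
  have h1 := hdiff (u t, t) ⟨t, ht, rfl⟩ (x, t) (by rwa [hn])
  rw [hn, one_mul] at h1
  have h2 : fderiv ℝ ↿v (u t, t) ((x, t) - (u t, t))
      = (fderiv ℝ ↿v (u t, t)).comp (.inl ℝ E ℝ) (x - u t) := by simp
  rw [h2] at h1
  have h3 := ((fderiv ℝ ↿v (u t, t)).comp (.inl ℝ E ℝ)).le_of_opNorm_le (hM t ht) (x - u t)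
  have h4 : M * ‖x - u t‖ ≤ |M| * ‖x - u t‖ := by gcongr; exact le_abs_self M
  have h5 := norm_sub_norm_le (v x t - v (u t) t)
    ((fderiv ℝ ↿v (u t, t)).comp (.inl ℝ E ℝ) (x - u t))
  simp only [HasUncurry.uncurry, id] at *
  linarith

variable {F : ℝ → ℝ → E} {s₀ : ℝ}

theorem exists_eventually_norm_sub_le_of_nonneg (hv : ContDiff ℝ 1 ↿v)
    (hF : ∀ s t, HasDerivAt (F s) (v (F s t) t) t) (h₀ : ContinuousAt (fun s => F s 0) s₀)
    (T : ℝ) :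
    ∃ C ≥ 0, ∀ᶠ s in 𝓝 s₀, ∀ t ∈ Icc 0 T, ‖F s t - F s₀ t‖ ≤ C * ‖F s 0 - F s₀ 0‖ := by
  have hu : Continuous (F s₀) := continuous_iff_continuousAt.2 fun t => (hF s₀ t).continuousAt
  obtain ⟨L, hL, δ, hδ, -, hlip⟩ := exists_lipschitz_near hv hu T
  refine ⟨exp (L * T), by positivity, ?_⟩
  have hlim : Tendsto (fun s => ‖F s 0 - F s₀ 0‖ * exp (L * T)) (𝓝 s₀) (𝓝 0) := by
    have : ContinuousAt (fun s => ‖F s 0 - F s₀ 0‖ * exp (L * T)) s₀ := by fun_prop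
    simpa [ContinuousAt] using this
  filter_upwards [hlim.eventually_lt_const hδ] with s hs t ht
  rw [mul_comm]
  exact norm_sub_le_of_lipschitz_near hL hlip (hF s₀) (hF s) hs t ht

theorem HasDerivAt.comp_neg_field (hF : ∀ s t, HasDerivAt (F s) (v (F s t) t) t) (s t : ℝ) :
    HasDerivAt (fun τ => F s (-τ)) (-v (F s (-t)) (-t)) t := by
  simpa [Function.comp_def] using (hF s (-t)).scomp t (hasDerivAt_neg t)

theorem ContDiff.neg_field (hv : ContDiff ℝ 1 ↿v) : ContDiff ℝ 1 ↿(fun x t => -v x (-t)) := by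
  have : ContDiff ℝ 1 fun p : E × ℝ => -(↿v) (p.1, -p.2) := by fun_prop
  exact this

/-- Joint continuity of a family of integral curves. -/
theorem continuousAt_uncurry_of_integralCurves (hv : ContDiff ℝ 1 ↿v)
    (hF : ∀ s t, HasDerivAt (F s) (v (F s t) t) t) (h₀ : ContinuousAt (fun s => F s 0) s₀)
    (t₀ : ℝ) : ContinuousAt ↿F (s₀, t₀) := by
  obtain ⟨C, hC, h1⟩ := exists_eventually_norm_sub_le_of_nonneg hv hF h₀ (|t₀| + 1)
  obtain ⟨C', hC', h2⟩ := exists_eventually_norm_sub_le_of_nonneg (F := fun s t => F s (-t))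
    hv.neg_field (HasDerivAt.comp_neg_field hF) (by simpa using h₀) (|t₀| + 1)
  have hu : ContinuousAt (fun p : ℝ × ℝ => F s₀ p.2) (s₀, t₀) :=
    ContinuousAt.comp (f := Prod.snd) (hF s₀ t₀).continuousAt continuousAt_snd
  have hd : ContinuousAt (fun p : ℝ × ℝ => (C + C') * ‖F p.1 0 - F s₀ 0‖) (s₀, t₀) := by
    have : ContinuousAt (fun p : ℝ × ℝ => F p.1 0) (s₀, t₀) :=
      ContinuousAt.comp (g := fun s => F s 0) (f := Prod.fst) h₀ continuousAt_fst
    fun_prop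
  have hz : Tendsto (fun p : ℝ × ℝ => F p.1 p.2 - F s₀ p.2) (𝓝 (s₀, t₀)) (𝓝 0) := by
    refine squeeze_zero_norm' ?_ (by simpa [ContinuousAt] using hd)
    have ht : ∀ᶠ t in 𝓝 t₀, |t| < |t₀| + 1 :=
      continuous_abs.continuousAt.eventually_lt continuousAt_const (by linarith)
    rw [nhds_prod_eq]
    filter_upwards [(h1.and h2).prod_mk ht] with ⟨s, t⟩ ⟨⟨hs, hs'⟩, ht⟩
    have hn := norm_nonneg (F s 0 - F s₀ 0)
    simp only at hs hs' ht ⊢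
    rcases le_total 0 t with h | h
    · have := hs t ⟨h, (le_abs_self t).trans ht.le⟩
      nlinarith
    · have := hs' (-t) ⟨by linarith, (neg_le_abs t).trans ht.le⟩
      simp only [neg_neg, neg_zero] at this
      nlinarith
  have := hz.add hu
  simp only [sub_add_cancel, zero_add] at this
  exact this

/-- Two integral curves of a `C¹` field which meet at some time coincide. -/
theorem integralCurves_eq_of_eq (hv : ContDiff ℝ 1 ↿v) {u w : ℝ → E}
    (hu : ∀ t, HasDerivAt u (v (u t) t) t) (hw : ∀ t, HasDerivAt w (v (w t) t) t) {t₀ : ℝ}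
    (h : u t₀ = w t₀) : u = w := by
  have huc : Continuous u := continuous_iff_continuousAt.2 fun t => (hu t).continuousAt
  have hwc : Continuous w := continuous_iff_continuousAt.2 fun t => (hw t).continuousAt
  ext t
  set R := |t| + |t₀| + 1
  have hK : IsCompact ((fun t => (u t, t)) '' Icc (-R) R ∪ (fun t => (w t, t)) '' Icc (-R) R) :=
    (isCompact_Icc.image (by fun_prop)).union (isCompact_Icc.image (by fun_prop))
  obtain ⟨K, hlip⟩ := LocallyLipschitzOn.exists_lipschitzOnWith_of_compact hK
    (LocallyLipschitz.locallyLipschitzOn (f := ↿v) hv.locallyLipschitz)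
  set S := (fun t => (u t, t)) '' Icc (-R) R ∪ (fun t => (w t, t)) '' Icc (-R) R
  have hmem : ∀ x : ℝ, |x| < R → x ∈ Ioo (-R) R := fun x hx => abs_lt.1 hx
  refine ODE_solution_unique_of_mem_Ioo (v := fun t x => v x t) (K := K)
    (s := fun t => {x | (x, t) ∈ S}) (a := -R) (b := R) (t₀ := t₀) (fun t _ => ?_)
    (hmem t₀ (by have := abs_nonneg t; simp only [R]; linarith))
    (fun t ht => ⟨hu t, Or.inl ⟨t, Ioo_subset_Icc_self ht, rfl⟩⟩)
    (fun t ht => ⟨hw t, Or.inr ⟨t, Ioo_subset_Icc_self ht, rfl⟩⟩) h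
    (hmem t (by have := abs_nonneg t₀; simp only [R]; linarith))
  refine LipschitzOnWith.of_dist_le_mul fun x hx y hy => ?_
  have : dist (v x t) (v y t) ≤ K * dist (x, t) (y, t) := hlip.dist_le_mul (x, t) hx (y, t) hy
  simpa [Prod.dist_eq] using this

variable [CompleteSpace E]

theorem differentiableAt_integralCurves_of_nonneg (hv : ContDiff ℝ 1 ↿v)
    (hF : ∀ s t, HasDerivAt (F s) (v (F s t) t) t) (h₀ : DifferentiableAt ℝ (fun s => F s 0) s₀)
    {T : ℝ} (hT : 0 ≤ T) : DifferentiableAt ℝ (fun s => F s T) s₀ := by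
  have hu : Continuous (F s₀) := continuous_iff_continuousAt.2 fun t => (hF s₀ t).continuousAt
  obtain ⟨L, hL, -, -, hA, -⟩ := exists_lipschitz_near hv hu T
  obtain ⟨C, hC, hclose⟩ := exists_eventually_norm_sub_le_of_nonneg hv hF h₀.continuousAt T
  have hslope := hasDerivAt_iff_tendsto_slope.1 h₀.hasDerivAt
  set g' := deriv (fun s => F s 0) s₀
  set q : ℝ → ℝ → E := fun s t => slope (fun s => F s t) s₀ s
  have hq0 : ∀ᶠ s in 𝓝[≠] s₀, ‖q s 0‖ < ‖g'‖ + 1 :=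
    hslope.norm.eventually_lt_const (by linarith)
  set M := C * (‖g'‖ + 1) with hM
  have hM0 : 0 ≤ M := by positivity
  have hqd : ∀ s t, HasDerivAt (q s) ((s - s₀)⁻¹ • (v (F s t) t - v (F s₀ t) t)) t := by
    intro s t
    have := ((hF s t).sub (hF s₀ t)).const_smul (s - s₀)⁻¹
    exact this
  -- the difference quotients are approximate solutions of the linearised equation
  have happrox : ∀ ε > 0, ∀ᶠ s in 𝓝[≠] s₀, ∀ t ∈ Icc 0 T,
      dist ((s - s₀)⁻¹ • (v (F s t) t - v (F s₀ t) t))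
        ((fderiv ℝ ↿v (F s₀ t, t)).comp (.inl ℝ E ℝ) (q s t)) ≤ ε * M := by
    intro ε hε
    have hK : IsCompact ((fun t => (F s₀ t, t)) '' Icc 0 T) := isCompact_Icc.image (by fun_prop)
    obtain ⟨δ, hδ, hdiff⟩ := hK.exists_norm_sub_sub_fderiv_le hv hε
    have hlim : ∀ᶠ s in 𝓝 s₀, C * ‖F s 0 - F s₀ 0‖ < δ := by
      have hc := h₀.continuousAt
      have : ContinuousAt (fun s => C * ‖F s 0 - F s₀ 0‖) s₀ := by fun_prop
      exact this.eventually_lt continuousAt_const (by simpa)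
    filter_upwards [hq0, nhdsWithin_le_nhds hclose, nhdsWithin_le_nhds hlim]
      with s hs0 hs1 hs2 t ht
    have hn : ‖((F s t, t) : E × ℝ) - (F s₀ t, t)‖ = ‖F s t - F s₀ t‖ := by simp [Prod.norm_def]
    have h1 := hdiff (F s₀ t, t) ⟨t, ht, rfl⟩ (F s t, t) (by rw [hn]; exact (hs1 t ht).trans_lt hs2)
    rw [hn] at h1
    have h2 : fderiv ℝ ↿v (F s₀ t, t) ((F s t, t) - (F s₀ t, t))
      = (fderiv ℝ ↿v (F s₀ t, t)).comp (.inl ℝ E ℝ) (F s t - F s₀ t) := by simp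
    rw [h2] at h1
    have h3 : q s t = (s - s₀)⁻¹ • (F s t - F s₀ t) := rfl
    have h4 : q s 0 = (s - s₀)⁻¹ • (F s 0 - F s₀ 0) := rfl
    rw [h3, map_smul, dist_eq_norm, ← smul_sub, norm_smul]
    rw [h4, norm_smul] at hs0
    calc _ ≤ ‖(s - s₀)⁻¹‖ * (ε * (C * ‖F s 0 - F s₀ 0‖)) := by
          gcongr
          exact h1.trans (by gcongr; exact hs1 t ht)
      _ = ε * (C * (‖(s - s₀)⁻¹‖ * ‖F s 0 - F s₀ 0‖)) := by ring
      _ ≤ ε * M := by rw [hM]; gcongr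
  have hcauchy : Cauchy (map (fun s => q s T) (𝓝[≠] s₀)) := by
    refine Metric.cauchy_iff.2 ⟨inferInstance, fun r hr => ?_⟩
    obtain ⟨ε, hε, hεr⟩ : ∃ ε > 0, gronwallBound (ε + ε) L (ε * M + ε * M) T < r := by
      have hc : Continuous fun ε => gronwallBound (ε + ε) L (ε * M + ε * M) T := by
        unfold gronwallBound
        split_ifs <;> fun_prop
      have h0 : gronwallBound ((0 : ℝ) + 0) L (0 * M + 0 * M) T = 0 := by
        simp [gronwallBound_ε0]
      have := hc.continuousAt.eventually_lt (x₀ := 0) continuousAt_const (by rw [h0]; exact hr)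
      obtain ⟨ε, h, h'⟩ := ((this.filter_mono (nhdsWithin_le_nhds (s := Ioi 0))).and
        self_mem_nhdsWithin).exists
      exact ⟨ε, h', h⟩
    refine ⟨_, image_mem_map ((happrox ε hε).and
      (hslope.eventually (Metric.ball_mem_nhds _ hε))), ?_⟩
    rintro _ ⟨s, ⟨hs, hs'⟩, rfl⟩ _ ⟨s', ⟨hs1, hs1'⟩, rfl⟩
    refine lt_of_le_of_lt ?_ hεr
    have := dist_le_of_approx_trajectories_ODE_of_mem (K := L.toNNReal) (a := 0) (b := T)
      (v := fun t x => (fderiv ℝ ↿v (F s₀ t, t)).comp (.inl ℝ E ℝ) x) (s := fun _ => univ)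
      (f := q s) (g := q s') (εf := ε * M) (εg := ε * M) (δ := ε + ε)
      (f' := fun t => (s - s₀)⁻¹ • (v (F s t) t - v (F s₀ t) t))
      (g' := fun t => (s' - s₀)⁻¹ • (v (F s' t) t - v (F s₀ t) t))
      (fun t ht => by
        refine (ContinuousLinearMap.lipschitz _).weaken ?_ |>.lipschitzOnWith
        rw [← NNReal.coe_le_coe, Real.coe_toNNReal _ hL]
        exact hA t (Ico_subset_Icc_self ht))
      (fun t _ => (hqd s t).continuousAt.continuousWithinAt)
      (fun t _ => (hqd s t).hasDerivWithinAt)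
      (fun t ht => hs t (Ico_subset_Icc_self ht)) (fun _ _ => mem_univ _)
      (fun t _ => (hqd s' t).continuousAt.continuousWithinAt)
      (fun t _ => (hqd s' t).hasDerivWithinAt)
      (fun t ht => hs1 t (Ico_subset_Icc_self ht)) (fun _ _ => mem_univ _)
      ((dist_triangle_right _ _ g').trans (add_le_add (le_of_lt hs') (le_of_lt hs1')))
      T (right_mem_Icc.2 hT)
    rwa [Real.coe_toNNReal _ hL, sub_zero] at this
  obtain ⟨l, hl⟩ := CompleteSpace.complete hcauchy
  exact (hasDerivAt_iff_tendsto_slope.2 hl).differentiableAt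

/-- Differentiability of a family of integral curves with respect to the parameter. -/
theorem differentiableAt_integralCurves (hv : ContDiff ℝ 1 ↿v)
    (hF : ∀ s t, HasDerivAt (F s) (v (F s t) t) t) (h₀ : DifferentiableAt ℝ (fun s => F s 0) s₀)
    (t : ℝ) : DifferentiableAt ℝ (fun s => F s t) s₀ := by
  rcases le_total 0 t with h | h
  · exact differentiableAt_integralCurves_of_nonneg hv hF h₀ h
  · simpa using differentiableAt_integralCurves_of_nonneg (F := fun s t => F s (-t)) hv.neg_field
      (HasDerivAt.comp_neg_field hF) (by simpa using h₀) (neg_nonneg.2 h)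

/-- Chain rule along `t ↦ (r t, t)` for a family of integral curves. -/
theorem hasDerivAt_integralCurves_comp (hv : ContDiff ℝ 1 ↿v)
    (hF : ∀ s t, HasDerivAt (F s) (v (F s t) t) t) {r : ℝ → ℝ} {r' t : ℝ} (hr : HasDerivAt r r' t)
    (h₀ : DifferentiableAt ℝ (fun s => F s 0) (r t)) :
    HasDerivAt (fun τ => F (r τ) τ) (r' • deriv (fun s => F s t) (r t) + v (F (r t) t) t) t := by
  have h1 : HasDerivAt (fun τ => F (r τ) t) (r' • deriv (fun s => F s t) (r t)) t :=
    (differentiableAt_integralCurves hv hF h₀ t).hasDerivAt.scomp t hr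
  have h2 : HasDerivAt (fun τ => F (r τ) τ - F (r τ) t) (v (F (r t) t) t) t := by
    have hc := continuousAt_uncurry_of_integralCurves hv hF h₀.continuousAt t
    have hVc : ContinuousAt (fun p : ℝ × ℝ => v (F p.1 p.2) p.2) (r t, t) :=
      ContinuousAt.comp (g := ↿v) (f := fun p : ℝ × ℝ => (F p.1 p.2, p.2))
        hv.continuous.continuousAt (hc.prodMk continuousAt_snd)
    rw [hasDerivAt_iff_isLittleO, Asymptotics.isLittleO_iff]
    intro ε hε
    obtain ⟨δ, hδ, hδ'⟩ := Metric.continuousAt_iff.1 hVc ε hε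
    obtain ⟨δ₁, hδ₁, hδ₁'⟩ := Metric.continuousAt_iff.1 hr.continuousAt δ hδ
    filter_upwards [Metric.ball_mem_nhds t (lt_min hδ hδ₁)] with τ hτ
    have hb := (convex_ball t δ).norm_image_sub_le_of_norm_hasDerivWithin_le
      (f := fun x => F (r τ) x - x • v (F (r t) t) t)
      (f' := fun x => v (F (r τ) x) x - (1 : ℝ) • v (F (r t) t) t) (C := ε)
      (fun x _ => ((hF (r τ) x).sub ((hasDerivAt_id x).smul_const _)).hasDerivWithinAt)
      (fun x hx => by
        rw [one_smul, ← dist_eq_norm]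
        refine (hδ' (x := (r τ, x)) ?_).le
        exact max_lt (hδ₁' (lt_of_lt_of_le hτ (min_le_right _ _))) hx)
      (Metric.mem_ball_self hδ) (Metric.ball_subset_ball (min_le_left _ _) hτ)
    convert hb using 2
    simp only [sub_self, sub_zero, sub_smul]
    abel
  convert h1.add h2 using 1
  ext τ
  simp

end ODE

/-- A continuous density along an injective curve is determined by the measure it defines. -/
theorem eqOn_of_forall_integral_mul_comp_eq {Y : Type*} [TopologicalSpace Y] [T4Space Y]
    {p q : ℝ} (hpq : p < q) {f g : ℝ → ℝ} {y : ℝ → Y} (hf : ContinuousOn f (Icc p q))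
    (hg : ContinuousOn g (Icc p q)) (hy : ContinuousOn y (Icc p q)) (hinj : InjOn y (Icc p q))
    (h : ∀ φ : Y → ℝ, Continuous φ →
      ∫ x in Icc p q, f x * φ (y x) = ∫ x in Icc p q, g x * φ (y x)) :
    EqOn f g (Icc p q) := by
  have he : Topology.IsClosedEmbedding ((Icc p q).domRestrict y) :=
    hy.domRestrict.isClosedEmbedding hinj.injective
  obtain ⟨φ, hφ⟩ := ContinuousMap.exists_extension' he
    ⟨(Icc p q).domRestrict (fun x => f x - g x), (hf.sub hg).domRestrict⟩
  have hφ' : ∀ x ∈ Icc p q, φ (y x) = f x - g x := fun x hx => congrFun hφ ⟨x, hx⟩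
  have hφc : ContinuousOn (fun x => φ (y x)) (Icc p q) := φ.continuous.comp_continuousOn hy
  have h0 : ∫ x in Icc p q, (f x - g x) ^ 2 = 0 := by
    have h1 := h φ φ.continuous
    rw [← sub_eq_zero, ← integral_sub (f := fun x => f x * φ (y x)) (g := fun x => g x * φ (y x))
      (hf.mul hφc).integrableOn_Icc (hg.mul hφc).integrableOn_Icc] at h1
    rw [← h1]
    refine setIntegral_congr_fun measurableSet_Icc fun x hx => ?_
    simp only [hφ' x hx]
    ring
  have h2 := (setIntegral_eq_zero_iff_of_nonneg_ae (Eventually.of_forall fun x => sq_nonneg _)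
    ((hf.sub hg).pow 2).integrableOn_Icc).1 h0
  refine Measure.eqOn_Icc_of_ae_eq volume hpq.ne ?_ hf hg
  filter_upwards [h2] with x hx
  have hx' : (f x - g x) ^ 2 = 0 := hx
  exact sub_eq_zero.1 (pow_eq_zero_iff two_ne_zero |>.1 hx')

/-- The product of a differentiable function and a continuous one, both vanishing at a point. -/
theorem HasDerivAt.mul_continuousAt_of_eq_zero {f h : ℝ → ℝ} {f' x : ℝ} (hf : HasDerivAt f f' x)
    (hh : ContinuousAt h x) (hfx : f x = 0) (hhx : h x = 0) :
    HasDerivAt (fun z => f z * h z) 0 x := by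
  rw [hasDerivAt_iff_isLittleO]
  have h1 : (fun z => f z) =O[𝓝 x] fun z => z - x := by simpa [hfx] using hf.isBigO_sub
  have h2 : h =o[𝓝 x] fun _ => (1 : ℝ) := by
    rw [Asymptotics.isLittleO_one_iff]
    simpa [ContinuousAt, hhx] using hh
  simpa [hfx] using h1.mul_isLittleO h2

section Partial

variable {E : Type*} [NormedAddCommGroup E] [NormedSpace ℝ E] {f : ℝ → ℝ → E}

theorem DifferentiableAt.hasDerivAt_fst {x t : ℝ} (hf : DifferentiableAt ℝ ↿f (x, t)) :
    HasDerivAt (fun z => f z t) (fderiv ℝ ↿f (x, t) (1, 0)) x :=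
  hf.hasFDerivAt.comp_hasDerivAt (f := fun z => (z, t)) x
    ((hasDerivAt_id x).prodMk (hasDerivAt_const x t))

theorem DifferentiableAt.hasDerivAt_snd {x t : ℝ} (hf : DifferentiableAt ℝ ↿f (x, t)) :
    HasDerivAt (fun z => f x z) (fderiv ℝ ↿f (x, t) (0, 1)) t :=
  hf.hasFDerivAt.comp_hasDerivAt (f := fun z => (x, z)) t
    ((hasDerivAt_const t x).prodMk (hasDerivAt_id t))

/-- The mixed partial derivatives of a `C²` function exist and agree. -/
theorem ContDiff.exists_hasDerivAt_mixed (hf : ContDiff ℝ 2 ↿f) (x t : ℝ) :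
    ∃ m, HasDerivAt (fun τ => fderiv ℝ ↿f (x, τ) (1, 0)) m t ∧
      HasDerivAt (fun z => fderiv ℝ ↿f (z, t) (0, 1)) m x := by
  have hd : Differentiable ℝ (fderiv ℝ ↿f) :=
    (hf.fderiv_right (m := 1) (by norm_num)).differentiable one_ne_zero
  have hsymm : IsSymmSndFDerivAt ℝ ↿f (x, t) :=
    hf.contDiffAt.isSymmSndFDerivAt (by simp)
  refine ⟨fderiv ℝ (fderiv ℝ ↿f) (x, t) (0, 1) (1, 0), ?_, ?_⟩
  · have : HasDerivAt (fun z => fderiv ℝ ↿f (x, z)) (fderiv ℝ (fderiv ℝ ↿f) (x, t) (0, 1)) t :=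
      DifferentiableAt.hasDerivAt_snd (f := fun x t => fderiv ℝ ↿f (x, t)) (hd (x, t))
    simpa using this.clm_apply (hasDerivAt_const t ((1, 0) : ℝ × ℝ))
  · rw [hsymm.eq]
    have : HasDerivAt (fun z => fderiv ℝ ↿f (z, t)) (fderiv ℝ (fderiv ℝ ↿f) (x, t) (1, 0)) x :=
      DifferentiableAt.hasDerivAt_fst (f := fun x t => fderiv ℝ ↿f (x, t)) (hd (x, t))
    simpa using this.clm_apply (hasDerivAt_const x ((0, 1) : ℝ × ℝ))

end Partial

/-- Let v be a smooth vector field with flow X, let C₀ be a smooth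
curve ξ₀ : [a,b] → ℝ² parametrized by arclength with smooth density γ₀, and let
μ(·,t) be the transport of μ₀ = γ₀ δ_{C₀} by v (i.e., the push-forward by X_t, which
acts on test functions φ by ∫ γ₀(s) φ(X_t(ξ₀(s))) ds).  Let y(η,t) be any smooth
parametrization of C_t = X_t(C₀) (via a smooth increasing reparametrization ρ), and
let σ be the continuous density of μ(·,t) in the parametrization y, i.e.
∫ φ dμ(·,t) = ∫ σ(η,t) φ(y(η,t)) dη for all continuous φ (this is equivalent to
σ(η,t) = γ(s(η,t),t) ∂s/∂η with s the arclength along C_t).  Then there exists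
a = a(η,t) with y_t + a y_η = v(y,t) and σ_t + (aσ)_η = 0. -/
theorem transport_lemma
    -- the smooth vector field and its flow
    (v : R2 → ℝ → R2) (hv : ContDiff ℝ (⊤ : ℕ∞) ↿v)
    (X : R2 → ℝ → R2) (hX0 : ∀ x, X x 0 = x)
    (hXflow : ∀ x t, HasDerivAt (fun τ => X x τ) (v (X x t) t) t)
    -- the smooth initial curve C₀, parametrized by arclength, with smooth density γ₀
    (a b : ℝ) (hab : a < b)
    (ξ0 : ℝ → R2) (hξ0 : ContDiff ℝ (⊤ : ℕ∞) ξ0)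
    (harc : ∀ s, ‖deriv ξ0 s‖ = 1) (hinj : InjOn ξ0 (Icc a b))
    (γ0 : ℝ → ℝ) (hγ0 : ContDiff ℝ (⊤ : ℕ∞) γ0)
    -- an arbitrary smooth parametrization y(η,t) of C_t = X_t(C₀)
    (η0 η1 : ℝ) (hη : η0 < η1)
    (ρ : ℝ → ℝ → ℝ) (hρ : ContDiff ℝ (⊤ : ℕ∞) ↿ρ)
    (hρmono : ∀ η t, 0 < deriv (fun η' => ρ η' t) η)
    (hρ0 : ∀ t, ρ η0 t = a) (hρ1 : ∀ t, ρ η1 t = b)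
    (y : ℝ → ℝ → R2) (hy : ∀ η t, y η t = X (ξ0 (ρ η t)) t)
    -- σ(η,t) = γ(s(η,t),t) ∂s/∂η : the density of the transported measure μ(·,t)
    -- in the parametrization y, characterized by the transport identity
    (σ : ℝ → ℝ → ℝ) (hσc : Continuous ↿σ)
    (hσ : ∀ (t : ℝ) (φ : R2 → ℝ), Continuous φ →
      (∫ s in Icc a b, γ0 s * φ (X (ξ0 s) t)) = ∫ η in Icc η0 η1, σ η t * φ (y η t)) :
    -- conclusion: there exists a(η,t) such that y_t + a y_η = v and σ_t + (aσ)_η = 0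
    ∃ A : ℝ → ℝ → ℝ, ∀ (t : ℝ), ∀ η ∈ Icc η0 η1,
      (deriv (fun τ => y η τ) t + A η t • deriv (fun η' => y η' t) η = v (y η t) t) ∧
      (∃ c : ℝ, HasDerivAt (fun τ => σ η τ) c t ∧
        HasDerivAt (fun η' => A η' t * σ η' t) (-c) η) := by
  have hv1 : ContDiff ℝ 1 ↿v := contDiff_infty.1 hv 1
  have hρ2 : ContDiff ℝ 2 ↿ρ := contDiff_infty.1 hρ 2
  have hρd : Differentiable ℝ ↿ρ := hρ2.differentiable two_ne_zero
  have hF : ∀ s t, HasDerivAt (X (ξ0 s)) (v (X (ξ0 s) t) t) t := fun s t => hXflow (ξ0 s) t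
  have hF0 : ∀ s, DifferentiableAt ℝ (fun s => X (ξ0 s) 0) s := by
    simp only [hX0]
    exact fun s => (hξ0.differentiable (by simp)) s
  have hγd : Differentiable ℝ γ0 := hγ0.differentiable (by simp)
  set D₁ : ℝ → ℝ → ℝ := fun η t => fderiv ℝ ↿ρ (η, t) (1, 0)
  set D₂ : ℝ → ℝ → ℝ := fun η t => fderiv ℝ ↿ρ (η, t) (0, 1)
  have hD₁ : ∀ η t, HasDerivAt (fun z => ρ z t) (D₁ η t) η := fun η t => (hρd (η, t)).hasDerivAt_fst
  have hD₂ : ∀ η t, HasDerivAt (fun z => ρ η z) (D₂ η t) t := fun η t => (hρd (η, t)).hasDerivAt_snd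
  have hpos : ∀ η t, 0 < D₁ η t := fun η t => (hD₁ η t).deriv ▸ hρmono η t
  have hD₁c : ∀ t, Continuous fun η => D₁ η t := fun t =>
    ((hρ2.continuous_fderiv two_ne_zero).comp (by fun_prop : Continuous fun η => (η, t))).clm_apply
      continuous_const
  have hρc : ∀ t, Continuous fun η => ρ η t := fun t =>
    continuous_iff_continuousAt.2 fun η => (hD₁ η t).continuousAt
  have hmono : ∀ t, StrictMono fun η => ρ η t := fun t => strictMono_of_deriv_pos fun η => hρmono η t
  have hmaps : ∀ t, MapsTo (fun η => ρ η t) (Icc η0 η1) (Icc a b) := fun t η hη' =>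
    ⟨hρ0 t ▸ (hmono t).monotone hη'.1, hρ1 t ▸ (hmono t).monotone hη'.2⟩
  have hXc : ∀ t, Continuous fun s => X (ξ0 s) t := fun t => continuous_iff_continuousAt.2
    fun s => (differentiableAt_integralCurves hv1 hF (hF0 s) t).continuousAt
  have hXinj : ∀ t, InjOn (fun s => X (ξ0 s) t) (Icc a b) := by
    intro t s hs s' hs' h
    have := congrFun (integralCurves_eq_of_eq hv1 (hF s) (hF s') h) 0
    exact hinj hs hs' (by simpa only [hX0] using this)
  have hσeq : ∀ t, EqOn (fun η => σ η t) (fun η => γ0 (ρ η t) * D₁ η t) (Icc η0 η1) := by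
    intro t
    refine eqOn_of_forall_integral_mul_comp_eq (y := fun η => X (ξ0 (ρ η t)) t) hη
      (hσc.comp (by fun_prop : Continuous fun η => (η, t))).continuousOn
      ((hγd.continuous.comp (hρc t)).mul (hD₁c t)).continuousOn
      ((hXc t).comp (hρc t)).continuousOn
      ((hXinj t).comp (hmono t).injective.injOn (hmaps t)) fun φ hφ => ?_
    have h1 := hσ t φ hφ
    simp only [hy] at h1
    rw [← h1, integral_Icc_eq_integral_Ioc, integral_Icc_eq_integral_Ioc,
      ← intervalIntegral.integral_of_le hab.le, ← intervalIntegral.integral_of_le hη.le]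
    have h2 := intervalIntegral.integral_comp_mul_deriv (a := η0) (b := η1)
      (g := fun s => γ0 s * φ (X (ξ0 s) t)) (fun η _ => hD₁ η t) (hD₁c t).continuousOn
      (hγd.continuous.mul (hφ.comp (hXc t)))
    rw [hρ0, hρ1] at h2
    rw [← h2]
    refine intervalIntegral.integral_congr fun η _ => ?_
    simp only [Function.comp]
    ring
  refine ⟨fun η t => -(D₂ η t / D₁ η t), fun t η hηI => ⟨?_, ?_⟩⟩
  · have ht := hasDerivAt_integralCurves_comp hv1 hF (hD₂ η t) (hF0 _)
    have hs := (differentiableAt_integralCurves hv1 hF (hF0 (ρ η t)) t).hasDerivAt.scomp η (hD₁ η t)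
    have hyt : (fun τ => y η τ) = fun τ => X (ξ0 (ρ η τ)) τ := funext fun τ => hy η τ
    have hyη : (fun η' => y η' t) = (fun s => X (ξ0 s) t) ∘ fun z => ρ z t :=
      funext fun z => hy z t
    rw [hyt, hyη, ht.deriv, hs.deriv, hy, smul_smul, neg_mul, div_mul_cancel₀ _ (hpos η t).ne', neg_smul]
    abel
  · obtain ⟨m, hm₁, hm₂⟩ := hρ2.exists_hasDerivAt_mixed η t
    have hγ := (hγd (ρ η t)).hasDerivAt
    refine ⟨deriv γ0 (ρ η t) * D₂ η t * D₁ η t + γ0 (ρ η t) * m, ?_, ?_⟩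
    · have h := (hγ.comp t (hD₂ η t)).mul hm₁
      refine h.congr_of_eventuallyEq (Eventually.of_forall fun τ => hσeq τ hηI)
    · have hflux : HasDerivAt (fun z => -(γ0 (ρ z t) * D₂ z t)) _ η :=
        ((hγ.comp η (hD₁ η t)).mul hm₂).neg
      have hrest : HasDerivAt
          (fun z => -(D₂ z t / D₁ z t) * (σ z t - γ0 (ρ z t) * D₁ z t)) 0 η := by
        rcases em (η ∈ Ioo η0 η1) with hint | hend
        · refine (hasDerivAt_const η (0 : ℝ)).congr_of_eventuallyEq ?_
          filter_upwards [Icc_mem_nhds hint.1 hint.2] with z hz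
          have := hσeq t hz
          simp only at this
          rw [this, sub_self, mul_zero]
        · have hzero : D₂ η t = 0 := by
            have hconst : ∃ c, ∀ τ, ρ η τ = c := by
              rcases eq_or_lt_of_le hηI.1 with h | h
              · exact ⟨a, h ▸ hρ0⟩
              · exact ⟨b, (hηI.2.eq_of_not_lt fun h' => hend ⟨h, h'⟩) ▸ hρ1⟩
            obtain ⟨c, hc⟩ := hconst
            have := hD₂ η t
            simp only [hc] at this
            exact this.unique (hasDerivAt_const t c)
          have hd : DifferentiableAt ℝ (fun z => D₁ z t) η := by
            have : Differentiable ℝ (fderiv ℝ ↿ρ) :=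
              (hρ2.fderiv_right (m := 1) (by norm_num)).differentiable one_ne_zero
            fun_prop
          refine (hm₂.div hd.hasDerivAt (hpos η t).ne').neg.mul_continuousAt_of_eq_zero ?_ ?_ ?_
          · have h1 : Continuous fun z => σ z t :=
              hσc.comp (by fun_prop : Continuous fun z => (z, t))
            exact (h1.sub ((hγd.continuous.comp (hρc t)).mul (hD₁c t))).continuousAt
          · simpa using Or.inl hzero
          · exact sub_eq_zero.2 (hσeq t hηI)
      refine ((hflux.add hrest).congr_deriv ?_).congr_of_eventuallyEq (Eventually.of_forall
        fun z => ?_)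
      · simp only [Function.comp, D₂]
        ring
      · have := (hpos z t).ne'
        simp only [Pi.add_apply]
        field_simp
        ring
end
end

section
/- Let φ : ℝ² → ℝ be twice continuously differentiable with bounded second derivatives. Then the function H_φ(x,y) := ((∇φ(x) − ∇φ(y))/2) · K(x−y), defined for x ≠ y, is continuous on {x ≠ y} and bounded, with |H_φ(x,y)| ≤ (1/(4π)) sup_{z∈ℝ²} ‖D²φ(z)‖ for all x ≠ y. -/
/-!
STATEMENT 8: the symmetrized kernel H_φ(x,y) = ((∇φ(x) − ∇φ(y))/2)·K(x−y) is
continuous off the diagonal and bounded by (1/(4π))·sup‖D²φ‖. -/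

open MeasureTheory Real Filter Set Function
open scoped Topology

noncomputable section

def perp (x : R2) : R2 := (WithLp.equiv 2 (Fin 2 → ℝ)).symm ![-(x 1), x 0]

def K (x : R2) : R2 := (2 * π * ‖x‖ ^ 2)⁻¹ • perp x

/-- H_φ(x,y) = ((∇φ(x) − ∇φ(y))/2) · K(x−y). -/
def Hphi (φ : R2 → ℝ) (x y : R2) : ℝ := ((fderiv ℝ φ x - fderiv ℝ φ y) (K (x - y))) / 2

lemma norm_perp (x : R2) : ‖perp x‖ = ‖x‖ := by
  simp [EuclideanSpace.norm_eq, perp, Fin.sum_univ_two, add_comm]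

lemma continuous_perp : Continuous perp := by
  refine (PiLp.continuous_toLp 2 _).comp (continuous_pi fun i => ?_)
  fin_cases i
  · exact (EuclideanSpace.proj (𝕜 := ℝ) (1 : Fin 2)).continuous.neg
  · exact (EuclideanSpace.proj (𝕜 := ℝ) (0 : Fin 2)).continuous

lemma norm_K {x : R2} (hx : x ≠ 0) : ‖K x‖ = (2 * π * ‖x‖)⁻¹ := by
  have hn : ‖x‖ ≠ 0 := norm_ne_zero_iff.mpr hx
  have hpos : 0 ≤ (2 * π * ‖x‖ ^ 2)⁻¹ := by positivity
  rw [K, norm_smul, norm_perp, Real.norm_of_nonneg hpos]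
  field_simp

lemma continuousOn_K : ContinuousOn K {x : R2 | x ≠ 0} := by
  have hc : ContinuousOn (fun x : R2 => 2 * π * ‖x‖ ^ 2) {x : R2 | x ≠ 0} := by fun_prop
  refine (hc.inv₀ fun x hx => ?_).smul continuous_perp.continuousOn
  have : ‖x‖ ≠ 0 := norm_ne_zero_iff.mpr hx
  positivity

lemma norm_fderiv_sub_le_of_iteratedFDeriv_two_le {E F : Type*}
    [NormedAddCommGroup E] [NormedSpace ℝ E] [NormedAddCommGroup F] [NormedSpace ℝ F]
    {f : E → F} (hf : ContDiff ℝ 2 f) {M : ℝ}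
    (hM : ∀ z, ‖iteratedFDeriv ℝ 2 f z‖ ≤ M) (x y : E) :
    ‖fderiv ℝ f x - fderiv ℝ f y‖ ≤ M * ‖x - y‖ := by
  have hd : Differentiable ℝ (fderiv ℝ f) :=
    (hf.fderiv_right (m := 1) (by norm_num)).differentiable (by norm_num)
  refine convex_univ.norm_image_sub_le_of_norm_fderiv_le (𝕜 := ℝ) (fun z _ => hd z)
    (fun z _ => ?_) (mem_univ y) (mem_univ x)
  rw [← norm_iteratedFDeriv_one, norm_iteratedFDeriv_fderiv]
  exact hM z

/-- If φ : ℝ² → ℝ is C² with second derivatives bounded by M, then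
H_φ is continuous on {x ≠ y} and satisfies |H_φ(x,y)| ≤ M/(4π) for all x ≠ y. -/
theorem Hphi_continuous_and_bounded (φ : R2 → ℝ) (hφ : ContDiff ℝ 2 φ)
    (M : ℝ) (hM : ∀ z : R2, ‖iteratedFDeriv ℝ 2 φ z‖ ≤ M) :
    ContinuousOn (fun p : R2 × R2 => Hphi φ p.1 p.2) {p : R2 × R2 | p.1 ≠ p.2} ∧
    ∀ x y : R2, x ≠ y → |Hphi φ x y| ≤ (4 * π)⁻¹ * M := by
  have hcont : Continuous (fderiv ℝ φ) := hφ.continuous_fderiv (by norm_num)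
  refine ⟨?_, fun x y hxy => ?_⟩
  · refine ContinuousOn.div_const (ContinuousOn.clm_apply ?_ ?_) 2
    · exact ((hcont.comp continuous_fst).sub (hcont.comp continuous_snd)).continuousOn
    · exact continuousOn_K.comp (continuous_fst.sub continuous_snd).continuousOn
        fun p hp => sub_ne_zero.mpr hp
  · have hn : ‖x - y‖ ≠ 0 := norm_ne_zero_iff.mpr (sub_ne_zero.mpr hxy)
    rw [Hphi, abs_div, abs_two, ← Real.norm_eq_abs]
    calc ‖(fderiv ℝ φ x - fderiv ℝ φ y) (K (x - y))‖ / 2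
        ≤ ‖fderiv ℝ φ x - fderiv ℝ φ y‖ * ‖K (x - y)‖ / 2 := by
          gcongr
          exact ContinuousLinearMap.le_opNorm _ _
      _ ≤ M * ‖x - y‖ * ‖K (x - y)‖ / 2 := by
          gcongr
          exact norm_fderiv_sub_le_of_iteratedFDeriv_two_le hφ hM x y
      _ = (4 * π)⁻¹ * M := by
          rw [norm_K (sub_ne_zero.mpr hxy)]
          field_simp
          norm_num
end
end

section
/- Consider the Prandtl-Munk vortex sheet: ξ₀(s) = (s,0) for −1 ≤ s ≤ 1 and γ₀(s) = s/√(1−s²). For every s ∈ (−1,1), the principal value Birkhoff-Rott velocity exists and equals (0, −1/2); explicitly, lim_{ε→0⁺} ∫_{{s' ∈ [−1,1] : |s−s'| ≥ ε}} (1/(2π(s−s'))) · (s'/√(1−s'²)) ds' = −1/2, while the first component of the velocity vanishes identically (since K(ξ₀(s)−ξ₀(s')) = (0, 1/(2π(s−s')))). -/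
/-!
STATEMENT 12: the Prandtl-Munk vortex sheet ξ₀(s) = (s,0), γ₀(s) = s/√(1−s²) on [−1,1]
has principal-value Birkhoff-Rott velocity (0,−1/2) at every s ∈ (−1,1). -/

open MeasureTheory Real Filter Set Function
open scoped Topology

noncomputable section

/-- The flat Prandtl-Munk sheet ξ₀(s) = (s,0). -/
def xiPM (s : ℝ) : R2 := (WithLp.equiv 2 (Fin 2 → ℝ)).symm ![s, 0]

/-- The Prandtl-Munk vorticity density γ₀(s) = s/√(1−s²). -/
def gammaPM (s : ℝ) : ℝ := s / Real.sqrt (1 - s ^ 2)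

theorem norm_xiPM_sub (s r : ℝ) : ‖xiPM s - xiPM r‖ = |s - r| := by
  simp [xiPM, EuclideanSpace.norm_eq, Fin.sum_univ_two, Real.sqrt_sq_eq_abs]

theorem K_xiPM_sub (s r : ℝ) :
    K (xiPM s - xiPM r) =
      (2 * π * (s - r))⁻¹ • ((WithLp.equiv 2 (Fin 2 → ℝ)).symm ![0, 1] : R2) := by
  rw [K, norm_xiPM_sub, sq_abs]
  ext i
  fin_cases i
  · simp [perp, xiPM]
  · rcases eq_or_ne (s - r) 0 with h | h
    · simp [h]
    · simp [perp, xiPM]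
      field_simp

theorem one_sub_mul_add_sqrt_pos {s r : ℝ} (hs : s ∈ Ioo (-1 : ℝ) 1) (hr : r ∈ Icc (-1 : ℝ) 1) :
    0 < 1 - s * r + √(1 - s ^ 2) * √(1 - r ^ 2) := by
  have h1 : 0 ≤ √(1 - s ^ 2) * √(1 - r ^ 2) := by positivity
  have h2 : 0 < 1 - s * r := by
    nlinarith [mul_nonneg (sub_nonneg.2 hs.1.le) (sub_nonneg.2 hr.2),
      mul_nonneg (sub_nonneg.2 hs.2.le) (sub_nonneg.2 hr.1), hs.1, hs.2, hr.1, hr.2]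
  linarith

/-- An antiderivative of `r ↦ (s - r)⁻¹ * √(1 - s ^ 2) / √(1 - r ^ 2)`. -/
def logPrimitive (s r : ℝ) : ℝ :=
  Real.log (1 - s * r + √(1 - s ^ 2) * √(1 - r ^ 2)) - Real.log (s - r)

/-- An antiderivative of the scalar Birkhoff-Rott integrand of the Prandtl-Munk sheet. -/
def velocityPrimitive (s r : ℝ) : ℝ :=
  (2 * π)⁻¹ * (-Real.arcsin r + s / √(1 - s ^ 2) * logPrimitive s r)

theorem hasDerivAt_logPrimitive {s r : ℝ} (hs : s ∈ Ioo (-1 : ℝ) 1) (hr : r ∈ Ioo (-1 : ℝ) 1)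
    (hrs : r ≠ s) :
    HasDerivAt (logPrimitive s) ((s - r)⁻¹ * (√(1 - s ^ 2) / √(1 - r ^ 2))) r := by
  have hpos := one_sub_mul_add_sqrt_pos hs (Ioo_subset_Icc_self hr)
  have hr2 : 0 < 1 - r ^ 2 := by nlinarith [hr.1, hr.2]
  have hs2 : 0 < 1 - s ^ 2 := by nlinarith [hs.1, hs.2]
  have hsr : s - r ≠ 0 := sub_ne_zero.2 hrs.symm
  have hw : HasDerivAt (fun x : ℝ => √(1 - x ^ 2)) (-(2 * r) / (2 * √(1 - r ^ 2))) r := by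
    have := (((hasDerivAt_id r).pow 2).const_sub 1).sqrt (by simpa using hr2.ne')
    simpa using this
  have h1 := ((((hasDerivAt_id r).const_mul s).const_sub 1).add
    (hw.const_mul √(1 - s ^ 2))).log (by simpa using hpos.ne')
  have h2 := ((hasDerivAt_id r).const_sub s).log (by simpa using hsr)
  refine (h1.sub h2).congr_deriv ?_
  simp only [id, Pi.add_apply]
  have hw0 : √(1 - r ^ 2) ≠ 0 := (Real.sqrt_pos.2 hr2).ne'
  have hwsq := Real.sq_sqrt hr2.le
  have hcsq := Real.sq_sqrt hs2.le
  generalize √(1 - r ^ 2) = w at *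
  generalize √(1 - s ^ 2) = c at *
  have hp := hpos.ne'
  field_simp
  linear_combination c * hwsq - w * hcsq

theorem hasDerivAt_velocityPrimitive {s r : ℝ} (hs : s ∈ Ioo (-1 : ℝ) 1)
    (hr : r ∈ Ioo (-1 : ℝ) 1) (hrs : r ≠ s) :
    HasDerivAt (velocityPrimitive s) ((2 * π * (s - r))⁻¹ * gammaPM r) r := by
  have hr2 : 0 < 1 - r ^ 2 := by nlinarith [hr.1, hr.2]
  have hs2 : 0 < 1 - s ^ 2 := by nlinarith [hs.1, hs.2]
  have hw0 : √(1 - r ^ 2) ≠ 0 := (Real.sqrt_pos.2 hr2).ne'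
  have hc0 : √(1 - s ^ 2) ≠ 0 := (Real.sqrt_pos.2 hs2).ne'
  have hsr : s - r ≠ 0 := sub_ne_zero.2 hrs.symm
  refine (((Real.hasDerivAt_arcsin hr.1.ne' hr.2.ne).neg.add
    ((hasDerivAt_logPrimitive hs hr hrs).const_mul (s / √(1 - s ^ 2)))).const_mul
      (2 * π)⁻¹).congr_deriv ?_
  rw [gammaPM]
  field_simp
  ring

theorem continuousOn_velocityPrimitive {s : ℝ} (hs : s ∈ Ioo (-1 : ℝ) 1) :
    ContinuousOn (velocityPrimitive s) (Icc (-1) 1 \ {s}) := by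
  have h1 : ContinuousOn (fun r => Real.log (1 - s * r + √(1 - s ^ 2) * √(1 - r ^ 2)))
      (Icc (-1) 1 \ {s}) :=
    ContinuousOn.log (by fun_prop) fun r hr => (one_sub_mul_add_sqrt_pos hs hr.1).ne'
  have h2 : ContinuousOn (fun r => Real.log (s - r)) (Icc (-1) 1 \ {s}) :=
    ContinuousOn.log (by fun_prop) fun r hr => sub_ne_zero.2 (Ne.symm hr.2)
  exact continuousOn_const.mul (Real.continuous_arcsin.continuousOn.neg.add
    (continuousOn_const.mul (h1.sub h2)))

theorem intervalIntegrable_inv_sqrt_one_sub_sq :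
    IntervalIntegrable (fun r : ℝ => 1 / √(1 - r ^ 2)) volume (-1) 1 :=
  intervalIntegral.intervalIntegrable_deriv_of_nonneg Real.continuous_arcsin.continuousOn
    (fun r hr => by
      rw [min_eq_left (by norm_num), max_eq_right (by norm_num)] at hr
      exact Real.hasDerivAt_arcsin hr.1.ne' hr.2.ne)
    fun r _ => by positivity

theorem intervalIntegrable_velocity {s a b : ℝ} (hab : a ≤ b) (ha : -1 ≤ a) (hb : b ≤ 1)
    (hsab : s ∉ Icc a b) :
    IntervalIntegrable (fun r => (2 * π * (s - r))⁻¹ * gammaPM r) volume a b := by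
  have h := intervalIntegrable_inv_sqrt_one_sub_sq.mono_set (c := a) (d := b) (by
    rw [uIcc_of_le hab, uIcc_of_le (by norm_num)]
    exact Icc_subset_Icc ha hb)
  have hc : ContinuousOn (fun r : ℝ => (2 * π * (s - r))⁻¹ * r) (uIcc a b) := by
    rw [uIcc_of_le hab]
    refine (ContinuousOn.inv₀ (by fun_prop) fun r hr => ?_).mul continuousOn_id
    have : s - r ≠ 0 := sub_ne_zero.2 fun h => hsab (h ▸ hr)
    positivity
  refine (h.continuousOn_mul hc).congr fun r _ => ?_
  simp only [gammaPM]
  ring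

theorem integral_Icc_velocity {s a b : ℝ} (hs : s ∈ Ioo (-1 : ℝ) 1) (hab : a ≤ b)
    (ha : -1 ≤ a) (hb : b ≤ 1) (hsab : s ∉ Icc a b) :
    ∫ r in Icc a b, (2 * π * (s - r))⁻¹ * gammaPM r =
      velocityPrimitive s b - velocityPrimitive s a := by
  rw [integral_Icc_eq_integral_Ioc, ← intervalIntegral.integral_of_le hab]
  refine intervalIntegral.integral_eq_sub_of_hasDerivAt_of_le hab
    ((continuousOn_velocityPrimitive hs).mono fun r hr =>
      ⟨⟨ha.trans hr.1, hr.2.trans hb⟩, fun h => hsab (h ▸ hr)⟩)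
    (fun r hr => hasDerivAt_velocityPrimitive hs ⟨ha.trans_lt hr.1, hr.2.trans_le hb⟩
      fun h => hsab (h ▸ Ioo_subset_Icc_self hr))
    (intervalIntegrable_velocity hab ha hb hsab)

theorem velocityPrimitive_one_sub_neg_one (s : ℝ) :
    velocityPrimitive s 1 - velocityPrimitive s (-1) = -(1 / 2) := by
  have h : Real.log (s - 1) = Real.log (1 - s) := by rw [← Real.log_neg_eq_log, neg_sub]
  simp only [velocityPrimitive, logPrimitive, Real.arcsin_one, Real.arcsin_neg_one]
  norm_num [h, add_comm]
  field_simp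
  ring

theorem tendsto_velocityPrimitive_sub {s : ℝ} (hs : s ∈ Ioo (-1 : ℝ) 1) :
    Tendsto (fun ε => velocityPrimitive s (s - ε) - velocityPrimitive s (s + ε)) (𝓝 0) (𝓝 0) := by
  have hpos := (one_sub_mul_add_sqrt_pos hs (Ioo_subset_Icc_self hs)).ne'
  have h : ContinuousAt (fun ε => (2 * π)⁻¹ * (-(Real.arcsin (s - ε) - Real.arcsin (s + ε)) +
      s / √(1 - s ^ 2) *
        (Real.log (1 - s * (s - ε) + √(1 - s ^ 2) * √(1 - (s - ε) ^ 2)) -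
          Real.log (1 - s * (s + ε) + √(1 - s ^ 2) * √(1 - (s + ε) ^ 2))))) 0 := by
    refine continuousAt_const.mul (ContinuousAt.add (Continuous.continuousAt ?_)
      (continuousAt_const.mul (ContinuousAt.sub ?_ ?_)))
    · exact ((Real.continuous_arcsin.comp (by fun_prop)).sub
        (Real.continuous_arcsin.comp (by fun_prop))).neg
    · exact ContinuousAt.log (by fun_prop) (by simpa using hpos)
    · exact ContinuousAt.log (by fun_prop) (by simpa using hpos)
  have h' := h.tendsto
  simp only [sub_zero, add_zero, sub_self, neg_zero, mul_zero] at h'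
  refine h'.congr fun ε => ?_
  simp only [velocityPrimitive, logPrimitive, sub_sub_cancel, sub_add_cancel_left,
    Real.log_neg_eq_log]
  ring

theorem setOf_Icc_and_le_abs_sub {a b s ε : ℝ} (hε : 0 ≤ ε) (ha : ε ≤ s - a) (hb : ε ≤ b - s) :
    {r | r ∈ Icc a b ∧ ε ≤ |s - r|} = Icc a (s - ε) ∪ Icc (s + ε) b := by
  ext r
  simp only [mem_ofPred_eq, mem_union, mem_Icc, le_abs]
  grind

theorem tendsto_scalar_velocity {s : ℝ} (hs : s ∈ Ioo (-1 : ℝ) 1) :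
    Tendsto (fun ε : ℝ =>
        ∫ r in {r | r ∈ Icc (-1 : ℝ) 1 ∧ ε ≤ |s - r|}, (2 * π * (s - r))⁻¹ * gammaPM r)
      (𝓝[>] 0) (𝓝 (-(1/2 : ℝ))) := by
  have h := ((tendsto_velocityPrimitive_sub hs).mono_left
    (nhdsWithin_le_nhds (s := Ioi 0))).add_const (-(1 / 2 : ℝ))
  rw [zero_add] at h
  refine h.congr' ?_
  have hδ : 0 < min (s - -1) (1 - s) := lt_min (by linarith [hs.1]) (by linarith [hs.2])
  filter_upwards [Ioo_mem_nhdsGT hδ] with ε hε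
  have hε0 : 0 < ε := hε.1
  have ha : ε ≤ s - -1 := hε.2.le.trans (min_le_left _ _)
  have hb : ε ≤ 1 - s := hε.2.le.trans (min_le_right _ _)
  have hl : s ∉ Icc (-1) (s - ε) := fun h => by linarith [h.2]
  have hr : s ∉ Icc (s + ε) 1 := fun h => by linarith [h.1]
  have hlε : -1 ≤ s - ε := by linarith
  have hrε : s + ε ≤ 1 := by linarith
  have hl1 : s - ε ≤ 1 := by linarith
  have hr1 : -1 ≤ s + ε := by linarith
  rw [setOf_Icc_and_le_abs_sub hε0.le ha hb, setIntegral_union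
    (Set.disjoint_left.2 fun r h h' => by linarith [h.2, h'.1]) measurableSet_Icc
    ((intervalIntegrable_iff_integrableOn_Icc_of_le hlε).1
      (intervalIntegrable_velocity hlε le_rfl hl1 hl))
    ((intervalIntegrable_iff_integrableOn_Icc_of_le hrε).1
      (intervalIntegrable_velocity hrε hr1 le_rfl hr)),
    integral_Icc_velocity hs hlε le_rfl hl1 hl, integral_Icc_velocity hs hrε hr1 le_rfl hr,
    ← velocityPrimitive_one_sub_neg_one s]
  ring

/-- For every s ∈ (−1,1), the principal-value Birkhoff-Rott velocity
of the Prandtl-Munk sheet exists and equals (0,−1/2); explicitly, the second component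
p.v. ∫_{−1}^{1} (2π(s−s'))⁻¹ γ₀(s') ds' = −1/2 and the first component vanishes
identically (K(ξ₀(s)−ξ₀(s')) = (0, 1/(2π(s−s')))). -/
theorem prandtl_munk_velocity (s : ℝ) (hs : s ∈ Ioo (-1 : ℝ) 1) :
    -- the vector-valued principal value equals (0, −1/2)
    Tendsto (fun ε : ℝ =>
        ∫ r in {r | r ∈ Icc (-1 : ℝ) 1 ∧ ε ≤ ‖xiPM s - xiPM r‖}, gammaPM r • K (xiPM s - xiPM r))
      (𝓝[>] 0) (𝓝 ((WithLp.equiv 2 (Fin 2 → ℝ)).symm ![0, -(1/2 : ℝ)])) ∧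
    -- the scalar (second-component) principal value equals −1/2
    Tendsto (fun ε : ℝ =>
        ∫ r in {r | r ∈ Icc (-1 : ℝ) 1 ∧ ε ≤ |s - r|}, (2 * π * (s - r))⁻¹ * gammaPM r)
      (𝓝[>] 0) (𝓝 (-(1/2 : ℝ))) ∧
    -- the first component of the kernel along the sheet vanishes
    (∀ r : ℝ, r ≠ s → K (xiPM s - xiPM r) 0 = 0 ∧
      K (xiPM s - xiPM r) 1 = (2 * π * (s - r))⁻¹) := by
  refine ⟨?_, tendsto_scalar_velocity hs, fun r _ => by simp [K_xiPM_sub]⟩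
  convert (tendsto_scalar_velocity hs).smul_const
    ((WithLp.equiv 2 (Fin 2 → ℝ)).symm ![0, 1] : R2) using 2 with ε
  · rw [← integral_smul_const]
    simp only [norm_xiPM_sub, K_xiPM_sub, smul_smul, mul_comm]
  · ext i
    fin_cases i <;> simp
end
end

section
/- Let (γ,ξ) be a weak solution of the Birkhoff-Rott equations with initial data (γ₀,ξ₀), where γ and ξ are C¹ and bounded with bounded first derivatives on Ω := {(s,t) : s₀(t) ≤ s ≤ s₁(t), 0 ≤ t < T} and U[ξ;γ] is continuous and bounded on Ω. Then the initial data are attained: for every ψ ∈ C_c^∞(ℝ²), ∫_{s₀(0)}^{s₁(0)} γ(s,0) ψ(ξ(s,0)) ds = ∫_{s₀(0)}^{s₁(0)} γ₀(s) ψ(ξ₀(s)) ds; that is, the measures γ(·,0) δ_{ξ(·,0)} and γ₀ δ_{ξ₀} coincide. In particular, if in addition ξ(·,0) and ξ₀ coincide and are one-to-one, then γ(s,0) = γ₀(s). -/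
/-!
STATEMENT 15: a weak Birkhoff-Rott solution with C¹_b regularity attains its initial
data: the measure γ(·,0) δ_{ξ(·,0)} coincides with γ₀ δ_{ξ₀}; in particular if
ξ(·,0) = ξ₀ is one-to-one then γ(·,0) = γ₀ (a.e.). -/

open MeasureTheory Real Filter Set Function
open scoped Topology

noncomputable section

/-- The Birkhoff-Rott principal-value velocity. -/
def HasBRVelocity (s0 s1 : ℝ) (ξ : ℝ → R2) (γ : ℝ → ℝ) (s : ℝ) (v : R2) : Prop :=
  Tendsto (fun ε : ℝ => ∫ r in {r | r ∈ Icc s0 s1 ∧ ε ≤ ‖ξ s - ξ r‖}, γ r • K (ξ s - ξ r))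
    (𝓝[>] 0) (𝓝 v)

/-- Test functions φ ∈ C_c^∞([0,T) × ℝ²). -/
def IsTest (T : ℝ) (φ : ℝ → R2 → ℝ) : Prop :=
  ContDiff ℝ (⊤ : ℕ∞) ↿φ ∧ HasCompactSupport ↿φ ∧ tsupport ↿φ ⊆ Iio T ×ˢ univ

/-- The weak Birkhoff-Rott identity with velocity `U` and initial data `(γ0, ξ0)`. -/
def WeakBRIdentity (T : ℝ) (s0 s1 : ℝ → ℝ) (ξ : ℝ → ℝ → R2) (γ : ℝ → ℝ → ℝ)
    (U : ℝ → ℝ → R2) (ξ0 : ℝ → R2) (γ0 : ℝ → ℝ) : Prop :=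
  ∀ φ : ℝ → R2 → ℝ, IsTest T φ →
    (∫ t in Ioo 0 T, ∫ s in Icc (s0 t) (s1 t),
      γ s t * (deriv (fun τ => φ τ (ξ s t)) t + fderiv ℝ (φ t) (ξ s t) (U s t)))
    + (∫ s in Icc (s0 0) (s1 0), γ0 s * φ 0 (ξ0 s)) = 0

/-- Weak solution of Birkhoff-Rott with prescribed velocity field `U`. -/
def IsWeakBRSolutionWith (T : ℝ) (s0 s1 : ℝ → ℝ) (ξ : ℝ → ℝ → R2) (γ : ℝ → ℝ → ℝ)
    (U : ℝ → ℝ → R2) (ξ0 : ℝ → R2) (γ0 : ℝ → ℝ) : Prop :=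
  (∃ M : ℝ, ∀ t ∈ Ico 0 T, IntegrableOn (fun s => γ s t) (Icc (s0 t) (s1 t)) ∧
      (∫ s in Icc (s0 t) (s1 t), |γ s t|) ≤ M ∧
      IntegrableOn (fun s => γ s t • U s t) (Icc (s0 t) (s1 t)) ∧
      (∫ s in Icc (s0 t) (s1 t), ‖γ s t • U s t‖) ≤ M) ∧
  WeakBRIdentity T s0 s1 ξ γ U ξ0 γ0

theorem continuous_parametric_intervalIntegral_moving {a b : ℝ → ℝ} {g : ℝ → ℝ → ℝ}
    (ha : Continuous a) (hb : Continuous b) (hg : Continuous ↿g) :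
    Continuous fun t => ∫ s in a t..b t, g s t := by
  have hg' : Continuous (fun t s => g s t).uncurry := hg.comp continuous_swap
  have hi : ∀ t c d, IntervalIntegrable (fun s => g s t) volume c d := fun t c d =>
    (hg.comp (Continuous.prodMk_left t)).intervalIntegrable c d
  have h : (fun t => ∫ s in a t..b t, g s t) =
      fun t => (∫ s in (0 : ℝ)..b t, g s t) - ∫ s in (0 : ℝ)..a t, g s t := by
    funext t
    exact (intervalIntegral.integral_interval_sub_left (hi t _ _) (hi t _ _)).symm
  rw [h]
  exact (intervalIntegral.continuous_parametric_intervalIntegral_of_continuous hg' hb).sub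
    (intervalIntegral.continuous_parametric_intervalIntegral_of_continuous hg' ha)

/-- If a continuous function `A` solves `A' = B` on `[0, T)` weakly with initial value `C`, where
`B` is continuous, then `A 0 = C`. -/
theorem eq_initial_value_of_weak_ode {T C : ℝ} (hT : 0 < T) {A B : ℝ → ℝ}
    (hA : Continuous A) (hB : Continuous B)
    (h : ∀ χ : ℝ → ℝ, ContDiff ℝ (⊤ : ℕ∞) χ → HasCompactSupport χ → tsupport χ ⊆ Iio T →
      (∫ t in (0 : ℝ)..T, (deriv χ t * A t + χ t * B t)) + χ 0 * C = 0) :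
    A 0 = C := by
  let f : ContDiffBump (0 : ℝ) := ⟨1 / 2, 1, by norm_num, by norm_num⟩
  have hf : ContDiff ℝ (⊤ : ℕ∞) f := f.contDiff
  have hf' : Continuous (deriv f) := hf.continuous_deriv (by simp)
  have hf0 : f 0 = 1 := f.one_of_mem_closedBall (by simp [f])
  have hf1 : f 1 = 0 := f.zero_of_le_dist (by simp [f])
  have hft : tsupport f = Metric.closedBall 0 1 := f.tsupport_eq
  let G : ℝ → ℝ := fun δ => ∫ u in (0 : ℝ)..1, (deriv f u * A (δ * u) + δ * (f u * B (δ * u)))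
  have hG : Continuous G := by
    refine intervalIntegral.continuous_parametric_intervalIntegral_of_continuous'
      (f := fun δ u => deriv f u * A (δ * u) + δ * (f u * B (δ * u))) ?_ 0 1
    have := hf.continuous
    unfold Function.uncurry
    fun_prop
  have hGC : ∀ δ ∈ Ioo 0 T, G δ = -C := by
    rintro δ ⟨h0, h1⟩
    let χ : ℝ → ℝ := fun t => f (δ⁻¹ * t)
    have hχ : ContDiff ℝ (⊤ : ℕ∞) χ := hf.comp (contDiff_const.mul contDiff_id)
    have hχ0 : ∀ t, t ∉ Metric.closedBall (0 : ℝ) δ → χ t = 0 := by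
      intro t ht
      refine f.zero_of_le_dist ?_
      simp only [Metric.mem_closedBall, dist_zero_right, Real.norm_eq_abs, not_le] at ht
      simp only [f, dist_zero_right, Real.norm_eq_abs, abs_mul, abs_inv, abs_of_pos h0]
      rw [inv_mul_eq_div, le_div_iff₀ h0]
      linarith
    have hts : tsupport χ ⊆ Metric.closedBall 0 δ :=
      closure_minimal (fun t ht => by_contra fun h' => ht (hχ0 t h')) Metric.isClosed_closedBall
    have hd : ∀ t, deriv χ t = δ⁻¹ * deriv f (δ⁻¹ * t) := by
      intro t
      simpa using deriv_comp_mul_left δ⁻¹ f t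
    have key := h χ hχ (HasCompactSupport.intro (isCompact_closedBall 0 δ) hχ0)
      (hts.trans fun t ht => by
        have := abs_le.1 (by simpa using ht : |t| ≤ δ)
        exact lt_of_le_of_lt this.2 h1)
    have hc : Continuous fun t => deriv χ t * A t + χ t * B t :=
      ((hχ.continuous_deriv (by simp)).mul hA).add (hχ.continuous.mul hB)
    have hz : (∫ t in δ..T, (deriv χ t * A t + χ t * B t)) = 0 := by
      refine intervalIntegral.integral_zero_ae (Eventually.of_forall fun t ht => ?_)
      rw [uIoc_of_le h1.le] at ht
      have hn : t ∉ tsupport χ := fun hm => by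
        have := abs_le.1 (by simpa using hts hm : |t| ≤ δ)
        linarith [ht.1]
      have h2 : χ t = 0 := image_eq_zero_of_notMem_tsupport hn
      have h3 : deriv χ t = 0 := image_eq_zero_of_notMem_tsupport fun hm =>
        hn (tsupport_deriv_subset hm)
      simp [h2, h3]
    rw [← intervalIntegral.integral_add_adjacent_intervals (hc.intervalIntegrable 0 δ)
      (hc.intervalIntegrable δ T), hz, add_zero] at key
    have hs := intervalIntegral.smul_integral_comp_mul_left
      (a := 0) (b := 1) (fun t => deriv χ t * A t + χ t * B t) δ
    rw [mul_zero, mul_one] at hs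
    rw [← hs, smul_eq_mul, ← intervalIntegral.integral_const_mul] at key
    have hGe : G δ = ∫ u in (0 : ℝ)..1,
        δ * (deriv χ (δ * u) * A (δ * u) + χ (δ * u) * B (δ * u)) := by
      refine intervalIntegral.integral_congr fun u _ => ?_
      simp only [hd, χ, inv_mul_cancel_left₀ h0.ne']
      field_simp
    have : χ 0 = 1 := by simp [χ, hf0]
    rw [this, ← hGe] at key
    linarith
  have hG0 : G 0 = -A 0 := by
    have hi : ∫ u in (0 : ℝ)..1, deriv f u = f 1 - f 0 :=
      intervalIntegral.integral_deriv_eq_sub (fun x _ => (hf.differentiable (by simp)) x)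
        (hf'.intervalIntegrable 0 1)
    simp [G, hi, hf0, hf1]
  have hlim : Tendsto G (𝓝[>] 0) (𝓝 (G 0)) := hG.continuousAt.tendsto.mono_left nhdsWithin_le_nhds
  have hconst : Tendsto G (𝓝[>] 0) (𝓝 (-C)) :=
    tendsto_const_nhds.congr' (by
      filter_upwards [Ioo_mem_nhdsGT hT] with δ hδ using (hGC δ hδ).symm)
  have := tendsto_nhds_unique hlim hconst
  linarith

theorem isTest_mul {T : ℝ} {χ : ℝ → ℝ} {ψ : R2 → ℝ} (hχ : ContDiff ℝ (⊤ : ℕ∞) χ)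
    (hχc : HasCompactSupport χ) (hχT : tsupport χ ⊆ Iio T) (hψ : ContDiff ℝ (⊤ : ℕ∞) ψ)
    (hψc : HasCompactSupport ψ) : IsTest T fun t x => χ t * ψ x := by
  have hts : tsupport ↿(fun t x => χ t * ψ x) ⊆ tsupport χ ×ˢ tsupport ψ := by
    refine closure_minimal (fun p hp => ?_) ((isClosed_tsupport χ).prod (isClosed_tsupport ψ))
    have hp' : χ p.1 * ψ p.2 ≠ 0 := hp
    exact ⟨subset_tsupport _ (left_ne_zero_of_mul hp'),
      subset_tsupport _ (right_ne_zero_of_mul hp')⟩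
  exact ⟨(hχ.comp contDiff_fst).mul (hψ.comp contDiff_snd),
    (hχc.isCompact.prod hψc.isCompact).of_isClosed_subset (isClosed_tsupport _) hts,
    hts.trans fun p hp => ⟨hχT hp.1, mem_univ _⟩⟩

/-- The indicator of a compact set is a pointwise limit of smooth compactly supported functions
with values in `[0, 1]`. -/
theorem IsCompact.exists_contDiff_tendsto_indicator {S : Set R2} (hS : IsCompact S) :
    ∃ ψ : ℕ → R2 → ℝ, (∀ n, ContDiff ℝ (⊤ : ℕ∞) (ψ n)) ∧ (∀ n, HasCompactSupport (ψ n)) ∧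
      (∀ n x, ψ n x ∈ Icc 0 1) ∧
      ∀ x, Tendsto (fun n => ψ n x) atTop (𝓝 (S.indicator 1 x)) := by
  obtain ⟨f, hfs, hf, hfr⟩ := hS.isClosed.isOpen_compl.exists_contDiff_support_eq (n := ⊤)
  have hf01 : ∀ x, f x ∈ Icc (0 : ℝ) 1 := fun x => hfr (mem_range_self x)
  obtain ⟨R, hR, hSR⟩ := hS.isBounded.subset_closedBall_lt 0 0
  let b : ContDiffBump (0 : R2) := ⟨R, R + 1, hR, by linarith⟩
  refine ⟨fun n x => b x * (1 - f x) ^ n, fun n => ?_, fun n => ?_, fun n x => ⟨?_, ?_⟩,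
    fun x => ?_⟩
  · exact b.contDiff.mul ((contDiff_const.sub hf).pow n)
  · exact b.hasCompactSupport.mul_right
  · exact mul_nonneg b.nonneg (pow_nonneg (by linarith [(hf01 x).2]) n)
  · exact mul_le_one₀ b.le_one (pow_nonneg (by linarith [(hf01 x).2]) n)
      (pow_le_one₀ (by linarith [(hf01 x).2]) (by linarith [(hf01 x).1]))
  · by_cases hx : x ∈ S
    · have h1 : f x = 0 := by
        rw [← notMem_support, hfs]
        simpa using hx
      have h2 : b x = 1 := b.one_of_mem_closedBall (hSR hx)
      simp [h1, h2, hx]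
    · have h1 : f x ≠ 0 := by
        rw [← mem_support, hfs]
        exact hx
      have h2 : 0 < f x := lt_of_le_of_ne (hf01 x).1 h1.symm
      simpa [hx] using (tendsto_pow_atTop_nhds_zero_of_lt_one
        (by linarith [(hf01 x).2]) (by linarith : 1 - f x < 1)).const_mul (b x)

/-- A density on an injective compact arc is determined by its integrals against smooth
compactly supported functions. -/
theorem ae_eq_zero_of_forall_integral_mul_comp_eq_zero {a b : ℝ} {η : ℝ → R2} {h : ℝ → ℝ}
    (hη : Continuous η) (hinj : InjOn η (Icc a b)) (hh : IntegrableOn h (Icc a b))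
    (H : ∀ ψ : R2 → ℝ, ContDiff ℝ (⊤ : ℕ∞) ψ → HasCompactSupport ψ →
      ∫ s in Icc a b, h s * ψ (η s) = 0) :
    h =ᵐ[volume.restrict (Icc a b)] 0 := by
  refine ae_eq_zero_of_forall_setIntegral_isClosed_eq_zero hh fun C hC => ?_
  obtain ⟨ψ, hψ, hψc, hψ01, hlim⟩ :=
    ((isCompact_Icc.inter_right hC).image (f := η) hη).exists_contDiff_tendsto_indicator
      (S := η '' (Icc a b ∩ C))
  have hind : ∀ s ∈ Icc a b, (η '' (Icc a b ∩ C)).indicator (1 : R2 → ℝ) (η s) =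
      C.indicator 1 s := by
    intro s hs
    have : η s ∈ η '' (Icc a b ∩ C) ↔ s ∈ C :=
      ⟨fun ⟨r, hr, he⟩ => hinj hr.1 hs he ▸ hr.2, fun hsC => ⟨s, ⟨hs, hsC⟩, rfl⟩⟩
    by_cases hsC : s ∈ C
    · simp [this.2 hsC, hsC]
    · rw [indicator_of_notMem (mt this.1 hsC), indicator_of_notMem hsC]
  have hT : Tendsto (fun n => ∫ s in Icc a b, h s * ψ n (η s)) atTop
      (𝓝 (∫ s in Icc a b, h s * C.indicator 1 s)) := by
    refine tendsto_integral_of_dominated_convergence (fun s => ‖h s‖) (fun n => ?_) hh.norm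
      (fun n => Eventually.of_forall fun s => ?_) ?_
    · exact hh.aestronglyMeasurable.mul ((hψ n).continuous.comp hη).aestronglyMeasurable
    · rw [norm_mul, Real.norm_of_nonneg (hψ01 n _).1]
      exact mul_le_of_le_one_right (norm_nonneg _) (hψ01 n _).2
    · filter_upwards [ae_restrict_mem measurableSet_Icc] with s hs
      rw [← hind s hs]
      exact (hlim (η s)).const_mul _
  simp only [H _ (hψ _) (hψc _)] at hT
  rw [← integral_indicator hC.measurableSet, ← tendsto_nhds_unique hT tendsto_const_nhds]
  refine integral_congr_ae (Eventually.of_forall fun s => ?_)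
  by_cases hsC : s ∈ C <;> simp [hsC]

/-- The weak identity tested against `χ(t) ψ(x)`, in terms of the moments of the vortex sheet. -/
theorem WeakBRIdentity.integral_moment_eq {T : ℝ} (hT : 0 < T) {s0 s1 : ℝ → ℝ}
    (hs : ∀ t ∈ Ico 0 T, s0 t ≤ s1 t) {ξ U : ℝ → ℝ → R2} {γ : ℝ → ℝ → ℝ}
    (hξ : Continuous ↿ξ) (hγ : Continuous ↿γ) (hU : Continuous ↿U) {ξ0 : ℝ → R2} {γ0 : ℝ → ℝ}
    (hweak : WeakBRIdentity T s0 s1 ξ γ U ξ0 γ0)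
    {ψ : R2 → ℝ} (hψ : ContDiff ℝ (⊤ : ℕ∞) ψ) (hψc : HasCompactSupport ψ)
    {χ : ℝ → ℝ} (hχ : ContDiff ℝ (⊤ : ℕ∞) χ) (hχc : HasCompactSupport χ)
    (hχT : tsupport χ ⊆ Iio T) :
    (∫ t in (0 : ℝ)..T, (deriv χ t * (∫ s in s0 t..s1 t, γ s t * ψ (ξ s t)) +
      χ t * (∫ s in s0 t..s1 t, γ s t * fderiv ℝ ψ (ξ s t) (U s t)))) +
      χ 0 * (∫ s in Icc (s0 0) (s1 0), γ0 s * ψ (ξ0 s)) = 0 := by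
  have hsl : ∀ t : ℝ, Continuous fun s : ℝ => (s, t) := fun t => Continuous.prodMk_left t
  have hcA : ∀ t, Continuous fun s => γ s t * ψ (ξ s t) := fun t =>
    (hγ.comp (hsl t)).mul (hψ.continuous.comp (hξ.comp (hsl t)))
  have hcB : ∀ t, Continuous fun s => γ s t * fderiv ℝ ψ (ξ s t) (U s t) := fun t =>
    (hγ.comp (hsl t)).mul
      (((hψ.continuous_fderiv (by simp)).comp (hξ.comp (hsl t))).clm_apply (hU.comp (hsl t)))
  refine Eq.trans ?_ (hweak _ (isTest_mul hχ hχc hχT hψ hψc))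
  rw [intervalIntegral.integral_of_le hT.le,
    integral_Ioc_eq_integral_Ioo, ← integral_const_mul]
  congr 1
  · refine setIntegral_congr_fun measurableSet_Ioo fun t ht => ?_
    rw [integral_Icc_eq_integral_Ioc, ← intervalIntegral.integral_of_le (hs t ⟨ht.1.le, ht.2⟩),
      ← intervalIntegral.integral_const_mul, ← intervalIntegral.integral_const_mul,
      ← intervalIntegral.integral_add (((hcA t).const_mul _).intervalIntegrable _ _)
        (((hcB t).const_mul _).intervalIntegrable _ _)]
    refine intervalIntegral.integral_congr fun s _ => ?_
    rw [deriv_mul_const (hχ.differentiable (by simp) t),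
      fderiv_const_mul (hψ.differentiable (by simp) _)]
    simp only [smul_apply, smul_eq_mul]
    ring
  · refine integral_congr_ae (Eventually.of_forall fun s => ?_)
    simp only
    ring

/-- Let (γ,ξ) be a weak Birkhoff-Rott solution with initial data
(γ₀,ξ₀), with γ, ξ ∈ C¹_b(Ω), U[ξ;γ] continuous and bounded, and C¹ finite endpoints.
Then the initial data are attained: for every ψ ∈ C_c^∞(ℝ²),
∫ γ(s,0) ψ(ξ(s,0)) ds = ∫ γ₀(s) ψ(ξ₀(s)) ds, i.e. γ(·,0) δ_{ξ(·,0)} = γ₀ δ_{ξ₀};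
in particular if ξ(·,0) = ξ₀ is one-to-one then γ(·,0) = γ₀ (ds-a.e.). -/
theorem weak_BR_attains_initial_data
    (T : ℝ) (hT : 0 < T)
    (s0 s1 : ℝ → ℝ) (hs0 : ContDiff ℝ 1 s0) (hs1 : ContDiff ℝ 1 s1)
    (hs : ∀ t ∈ Ico 0 T, s0 t ≤ s1 t)
    (ξ : ℝ → ℝ → R2) (γ : ℝ → ℝ → ℝ)
    (hξ : ContDiff ℝ 1 ↿ξ) (hγ : ContDiff ℝ 1 ↿γ)
    (M : ℝ)
    (hbd : ∀ s t : ℝ, ‖ξ s t‖ ≤ M ∧ ‖fderiv ℝ ↿ξ (s, t)‖ ≤ M ∧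
      |γ s t| ≤ M ∧ ‖fderiv ℝ ↿γ (s, t)‖ ≤ M)
    -- the Birkhoff-Rott velocity field, continuous and bounded
    (U : ℝ → ℝ → R2)
    (hUpv : ∀ t ∈ Ico 0 T, ∀ s ∈ Icc (s0 t) (s1 t),
      HasBRVelocity (s0 t) (s1 t) (fun r => ξ r t) (fun r => γ r t) s (U s t))
    (hUc : Continuous ↿U) (MU : ℝ) (hUb : ∀ s t : ℝ, ‖U s t‖ ≤ MU)
    -- the initial data
    (ξ0 : ℝ → R2) (γ0 : ℝ → ℝ) (hγ0 : IntegrableOn γ0 (Icc (s0 0) (s1 0)))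
    -- (γ,ξ) is a weak solution with initial data (γ₀,ξ₀)
    (hweak : IsWeakBRSolutionWith T s0 s1 ξ γ U ξ0 γ0) :
    -- the initial measures coincide
    (∀ ψ : R2 → ℝ, ContDiff ℝ (⊤ : ℕ∞) ψ → HasCompactSupport ψ →
      (∫ s in Icc (s0 0) (s1 0), γ s 0 * ψ (ξ s 0))
        = ∫ s in Icc (s0 0) (s1 0), γ0 s * ψ (ξ0 s)) ∧
    -- in particular, if ξ(·,0) = ξ₀ and it is one-to-one, then γ(·,0) = γ₀ a.e.
    ((∀ s, ξ s 0 = ξ0 s) → InjOn (fun s => ξ s 0) (Icc (s0 0) (s1 0)) →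
      ∀ᵐ s ∂(volume.restrict (Icc (s0 0) (s1 0))), γ s 0 = γ0 s) := by
  have hint : ∀ ψ : R2 → ℝ, ContDiff ℝ (⊤ : ℕ∞) ψ → HasCompactSupport ψ →
      (∫ s in Icc (s0 0) (s1 0), γ s 0 * ψ (ξ s 0))
        = ∫ s in Icc (s0 0) (s1 0), γ0 s * ψ (ξ0 s) := by
    intro ψ hψ hψc
    have hA := continuous_parametric_intervalIntegral_moving hs0.continuous hs1.continuous
      (g := fun s t => γ s t * ψ (ξ s t)) (hγ.continuous.mul (hψ.continuous.comp hξ.continuous))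
    have hB := continuous_parametric_intervalIntegral_moving hs0.continuous hs1.continuous
      (g := fun s t => γ s t * fderiv ℝ ψ (ξ s t) (U s t))
      (hγ.continuous.mul
        (((hψ.continuous_fderiv (by simp)).comp hξ.continuous).clm_apply hUc))
    have h := eq_initial_value_of_weak_ode hT hA hB fun χ hχ hχc hχT =>
      hweak.2.integral_moment_eq hT hs hξ.continuous hγ.continuous hUc hψ hψc hχ hχc hχT
    rwa [integral_Icc_eq_integral_Ioc, ← intervalIntegral.integral_of_le (hs 0 ⟨le_rfl, hT⟩)]
  refine ⟨hint, fun heq hinj => ?_⟩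
  have hη : Continuous fun s => ξ s 0 := hξ.continuous.comp (Continuous.prodMk_left 0)
  have hγc : Continuous fun s => γ s 0 := hγ.continuous.comp (Continuous.prodMk_left 0)
  have hγi : IntegrableOn (fun s => γ s 0) (Icc (s0 0) (s1 0)) :=
    hγc.continuousOn.integrableOn_Icc
  have hz : (fun s => γ s 0 - γ0 s) =ᵐ[volume.restrict (Icc (s0 0) (s1 0))] 0 := by
    refine ae_eq_zero_of_forall_integral_mul_comp_eq_zero hη hinj (hγi.sub hγ0) ?_
    intro ψ hψ hψc
    have hψη : Continuous fun s => ψ (ξ s 0) := hψ.continuous.comp hη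
    have h2 : IntegrableOn (fun s => γ0 s * ψ (ξ s 0)) (Icc (s0 0) (s1 0)) :=
      hγ0.mul_continuousOn hψη.continuousOn isCompact_Icc
    have h1 : IntegrableOn (fun s => γ s 0 * ψ (ξ s 0)) (Icc (s0 0) (s1 0)) :=
      hγi.mul_continuousOn hψη.continuousOn isCompact_Icc
    have h3 := hint ψ hψ hψc
    simp only [← heq] at h3
    simp only [sub_mul]
    rw [integral_sub h1 h2, h3, sub_self]
  filter_upwards [hz] with s hs'
  exact sub_eq_zero.1 hs'
end
end
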